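/- arXiv:1606.08643 — 5 statements merged into one kernel-verified Lean document; each statement's English description precedes it below -/
import Mathlib

section
/- Let G be a group and let x_1, x_2, …, x_{2m} be elements of G (m ≥ 1) such that x_i x_j = x_j x_i whenever |i − j| ≥ 2. Then the element (x_1 x_3 ⋯ x_{2m−1})·(x_2 x_4 ⋯ x_{2m}) is conjugate in G to x_1 x_2 ⋯ x_{2m}. -/
/-- A conjugator taking `x_1 ⋯ x_{2k}` to `(x_1 x_3 ⋯ x_{2k-1}) (x_2 x_4 ⋯ x_{2k})` can be chosen
to commute with all later `x_j`. -/
theorem exists_commute_semiconjBy_odd_even {G : Type*} [Group G] (N : ℕ) (x : ℕ → G)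
    (hcomm : ∀ i j, 1 ≤ i → j ≤ N → i + 2 ≤ j → x i * x j = x j * x i) (k : ℕ) (hk : 2 * k ≤ N) :
    ∃ g : G, (∀ j, 2 * k + 1 ≤ j → j ≤ N → Commute g (x j)) ∧
      SemiconjBy g (((List.range (2 * k)).map fun i => x (i + 1)).prod)
        (((List.range k).map fun i => x (2 * i + 1)).prod *
          ((List.range k).map fun i => x (2 * i + 2)).prod) := by
  induction k with
  | zero => exact ⟨1, fun _ _ _ => Commute.one_left _, by simp⟩
  | succ k ih =>
    obtain ⟨g, hg, h⟩ := ih (by lia)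
    have hodd (j : ℕ) (h1 : 2 * k + 1 ≤ j) (h2 : j ≤ N) :
        Commute ((List.range k).map fun i => x (2 * i + 1)).prod (x j) := by
      refine Commute.list_prod_left _ _ fun y hy => ?_
      obtain ⟨i, hi, rfl⟩ := List.mem_map.1 hy
      have := List.mem_range.1 hi
      exact hcomm _ _ (by lia) h2 (by lia)
    have heven (j : ℕ) (h1 : 2 * k + 2 ≤ j) (h2 : j ≤ N) :
        Commute ((List.range k).map fun i => x (2 * i + 2)).prod (x j) := by
      refine Commute.list_prod_left _ _ fun y hy => ?_
      obtain ⟨i, hi, rfl⟩ := List.mem_map.1 hy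
      have := List.mem_range.1 hi
      exact hcomm _ _ (by lia) h2 (by lia)
    rw [show 2 * (k + 1) = 2 * k + 1 + 1 by ring]
    simp only [List.range_succ, List.map_append, List.prod_append, List.map_singleton,
      List.prod_singleton]
    generalize ((List.range k).map fun i => x (2 * i + 1)).prod = a at *
    generalize ((List.range k).map fun i => x (2 * i + 2)).prod = b at *
    generalize ((List.range (2 * k)).map fun i => x (i + 1)).prod = p at *
    refine ⟨(a * b)⁻¹ * g, fun j h1 h2 => ?_, ?_⟩
    · exact ((hodd j (by lia) h2).mul_left (heven j (by lia) h2)).inv_left.mul_left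
        (hg j (by lia) h2)
    have gu := hg (2 * k + 1) le_rfl (by lia)
    have gv := hg (2 * k + 2) (by lia) (by lia)
    have au := hodd (2 * k + 1) le_rfl (by lia)
    have av := hodd (2 * k + 2) (by lia) (by lia)
    have bv := heven (2 * k + 2) le_rfl (by lia)
    rw [show 2 * k + 1 + 1 = 2 * k + 2 by rfl]
    generalize x (2 * k + 1) = u at *
    generalize x (2 * k + 2) = v at *
    calc (a * b)⁻¹ * g * (p * u * v) = (a * b)⁻¹ * (g * p) * (u * v) := by group
      _ = g * (u * v) := by rw [h.eq]; group
      _ = u * v * g := (gu.mul_right gv).eq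
      _ = (u * v) * a * a⁻¹ * g := by group
      _ = a * (u * v) * a⁻¹ * g := by rw [(au.mul_right av).eq]
      _ = a * u * (v * b) * b⁻¹ * a⁻¹ * g := by group
      _ = a * u * (b * v) * ((a * b)⁻¹ * g) := by rw [bv.eq]; group


/-- Let `G` be a group and `x_1, …, x_{2m}` elements of `G` (with `m ≥ 1`)
such that `x_i x_j = x_j x_i` whenever `|i − j| ≥ 2`.  Then
`(x_1 x_3 ⋯ x_{2m−1}) · (x_2 x_4 ⋯ x_{2m})` is conjugate in `G` to `x_1 x_2 ⋯ x_{2m}`. -/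
theorem odd_even_reorder_isConj_even_case {G : Type*} [Group G] (m : ℕ) (hm : 1 ≤ m)
    (x : ℕ → G)
    (hcomm : ∀ i j, 1 ≤ i → j ≤ 2 * m → i + 2 ≤ j → x i * x j = x j * x i) :
    IsConj
      (((List.range m).map fun k => x (2 * k + 1)).prod *
        ((List.range m).map fun k => x (2 * k + 2)).prod)
      (((List.range (2 * m)).map fun k => x (k + 1)).prod) := by
  obtain ⟨g, -, h⟩ := exists_commute_semiconjBy_odd_even (2 * m) x hcomm m le_rfl
  exact (isConj_iff.2 ⟨g, mul_inv_eq_of_eq_mul h.eq⟩).symm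
end

section
/- Let G be a group and let x_1, x_2, …, x_{2m+1} be elements of G (m ≥ 1) such that x_i x_j = x_j x_i whenever |i − j| ≥ 2. Then the element (x_1 x_3 ⋯ x_{2m+1})·(x_2 x_4 ⋯ x_{2m}) is conjugate in G to x_1 x_2 ⋯ x_{2m+1}. -/
theorem commute_list_range_map_prod {M : Type*} [Monoid M] {f : ℕ → M} {n : ℕ} {y : M}
    (h : ∀ k < n, Commute (f k) y) : Commute ((List.range n).map f).prod y := by
  refine Commute.list_prod_left _ _ fun z hz => ?_
  obtain ⟨k, hk, rfl⟩ := List.mem_map.1 hz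
  exact h k (List.mem_range.1 hk)

/-- The conjugating element can be chosen to commute with everything that commutes with
`x_1, …, x_{2m}`. -/
theorem exists_semiconjBy_odd_even_reorder {G : Type*} [Group G] (x : ℕ → G) (m : ℕ)
    (hcomm : ∀ i j, 1 ≤ i → j ≤ 2 * m + 1 → i + 2 ≤ j → Commute (x i) (x j)) :
    ∃ g : G,
      SemiconjBy g
        (((List.range (m + 1)).map fun k => x (2 * k + 1)).prod *
          ((List.range m).map fun k => x (2 * k + 2)).prod)
        (((List.range (2 * m + 1)).map fun k => x (k + 1)).prod) ∧
      ∀ y, (∀ i, 1 ≤ i → i ≤ 2 * m → Commute (x i) y) → Commute g y := by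
  induction m with
  | zero => exact ⟨1, by simp [SemiconjBy], fun y _ => Commute.one_left y⟩
  | succ m ih =>
    obtain ⟨g, hg, hgy⟩ := ih fun i j hi hj hij => hcomm i j hi (by lia) hij
    have hgb : Commute g (x (2 * m + 2)) :=
      hgy _ fun i hi him => hcomm _ _ hi (by lia) (by lia)
    have hgc : Commute g (x (2 * m + 3)) :=
      hgy _ fun i hi him => hcomm _ _ hi (by lia) (by lia)
    have hAc : Commute ((List.range (m + 1)).map fun k => x (2 * k + 1)).prod (x (2 * m + 3)) :=
      commute_list_range_map_prod fun k hk => hcomm _ _ (by lia) (by lia) (by lia)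
    have hAy : ∀ y, (∀ i, 1 ≤ i → i ≤ 2 * (m + 1) → Commute (x i) y) →
        Commute ((List.range (m + 1)).map fun k => x (2 * k + 1)).prod y := fun y hy =>
      commute_list_range_map_prod fun k hk => hy _ (by lia) (by lia)
    have hBy : ∀ y, (∀ i, 1 ≤ i → i ≤ 2 * (m + 1) → Commute (x i) y) →
        Commute ((List.range m).map fun k => x (2 * k + 2)).prod y := fun y hy =>
      commute_list_range_map_prod fun k hk => hy _ (by lia) (by lia)
    rw [List.prod_range_succ (fun k => x (2 * k + 1)) (m + 1),
      List.prod_range_succ (fun k => x (2 * k + 2)) m,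
      show 2 * (m + 1) + 1 = 2 * m + 1 + 1 + 1 by ring, List.prod_range_succ _ (2 * m + 1 + 1),
      List.prod_range_succ _ (2 * m + 1)]
    generalize ((List.range (m + 1)).map fun k => x (2 * k + 1)).prod = A at *
    generalize ((List.range m).map fun k => x (2 * k + 2)).prod = B at *
    generalize ((List.range (2 * m + 1)).map fun k => x (k + 1)).prod = P at *
    refine ⟨g * (A * B * x (2 * m + 2)), ?_, fun y hy => ?_⟩
    · change SemiconjBy _ (A * x (2 * m + 3) * (B * x (2 * m + 2)))
        (P * x (2 * m + 2) * x (2 * m + 3))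
      refine SemiconjBy.mul_left ((hg.mul_right hgb).mul_right hgc) ?_
      rw [SemiconjBy, hAc.eq]
      simp only [mul_assoc]
    · exact (hgy y fun i hi him => hy i hi (by lia)).mul_left
        (((hAy y hy).mul_left (hBy y hy)).mul_left (hy _ (by lia) (by lia)))


/-- Let `G` be a group and `x_1, …, x_{2m+1}` elements of `G` (with `m ≥ 1`)
such that `x_i x_j = x_j x_i` whenever `|i − j| ≥ 2`.  Then
`(x_1 x_3 ⋯ x_{2m+1}) · (x_2 x_4 ⋯ x_{2m})` is conjugate in `G` to `x_1 x_2 ⋯ x_{2m+1}`. -/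
theorem odd_even_reorder_isConj_odd_case {G : Type*} [Group G] (m : ℕ) (hm : 1 ≤ m)
    (x : ℕ → G)
    (hcomm : ∀ i j, 1 ≤ i → j ≤ 2 * m + 1 → i + 2 ≤ j → x i * x j = x j * x i) :
    IsConj
      (((List.range (m + 1)).map fun k => x (2 * k + 1)).prod *
        ((List.range m).map fun k => x (2 * k + 2)).prod)
      (((List.range (2 * m + 1)).map fun k => x (k + 1)).prod) := by
  obtain ⟨g, hg, -⟩ := exists_semiconjBy_odd_even_reorder x m hcomm
  exact ⟨toUnits g, hg⟩
end

section
/- Let G be a group and let x_1, …, x_{2m+1} be elements of G such that x_i x_j = x_j x_i whenever |i − j| ≥ 2. For 0 ≤ k ≤ m−1 define X_{2k+1} = x_1 x_2 ⋯ x_{2k+1} · x_{2k+3} x_{2k+5} ⋯ x_{2m+1} · x_{2k+2} x_{2k+4} ⋯ x_{2m} and X_{2k} = x_1 x_2 ⋯ x_{2k} · x_{2k+2} x_{2k+4} ⋯ x_{2m} · x_{2k+1} x_{2k+3} ⋯ x_{2m+1}. Then (x_{2k+2} x_{2k+4} ⋯ x_{2m}) · X_{2k+1} · (x_{2k+2}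 x_{2k+4} ⋯ x_{2m})^{-1} = X_{2k}; in particular X_{2k+1} is conjugate to X_{2k} in G. -/
/-- Let `G` be a group and `x_1, …, x_{2m+1}` elements of `G` such that
`x_i x_j = x_j x_i` whenever `|i − j| ≥ 2`.  For `0 ≤ k ≤ m − 1` set
`X_{2k+1} = x_1 ⋯ x_{2k+1} · x_{2k+3} x_{2k+5} ⋯ x_{2m+1} · x_{2k+2} x_{2k+4} ⋯ x_{2m}` and
`X_{2k}  = x_1 ⋯ x_{2k} · x_{2k+2} x_{2k+4} ⋯ x_{2m} · x_{2k+1} x_{2k+3} ⋯ x_{2m+1}`.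
Then `(x_{2k+2} x_{2k+4} ⋯ x_{2m}) · X_{2k+1} · (x_{2k+2} x_{2k+4} ⋯ x_{2m})⁻¹ = X_{2k}`;
in particular `X_{2k+1}` is conjugate to `X_{2k}` in `G`.

Here `A₁ = x_1 ⋯ x_{2k+1}`, `A₀ = x_1 ⋯ x_{2k}`, `B = x_{2k+3} x_{2k+5} ⋯ x_{2m+1}`,
`C = x_{2k+2} x_{2k+4} ⋯ x_{2m}` and `E = x_{2k+1} x_{2k+3} ⋯ x_{2m+1}`, so that
`X_{2k+1} = A₁ B C` and `X_{2k} = A₀ C E`. -/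
theorem conj_X_odd_eq_X_even {G : Type*} [Group G] (m k : ℕ) (hk : k + 1 ≤ m)
    (x : ℕ → G)
    (hcomm : ∀ i j, 1 ≤ i → j ≤ 2 * m + 1 → i + 2 ≤ j → x i * x j = x j * x i)
    (A₁ A₀ B C E : G)
    (hA₁ : A₁ = ((List.range (2 * k + 1)).map fun i => x (i + 1)).prod)
    (hA₀ : A₀ = ((List.range (2 * k)).map fun i => x (i + 1)).prod)
    (hB : B = ((List.range (m - k)).map fun j => x (2 * k + 3 + 2 * j)).prod)
    (hC : C = ((List.range (m - k)).map fun j => x (2 * k + 2 + 2 * j)).prod)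
    (hE : E = ((List.range (m - k + 1)).map fun j => x (2 * k + 1 + 2 * j)).prod) :
    C * (A₁ * B * C) * C⁻¹ = A₀ * C * E ∧ IsConj (A₁ * B * C) (A₀ * C * E) := by
  have hA : A₁ = A₀ * x (2 * k + 1) := by
    rw [hA₁, hA₀, List.prod_range_succ]
  have hEB : E = x (2 * k + 1) * B := by
    rw [hE, hB, List.prod_range_succ']
    congr! 5 with j
    lia
  have hCA : Commute C A₀ := by
    rw [hC, hA₀]
    refine Commute.list_prod_left _ _ fun a ha => Commute.list_prod_right _ _ fun b hb => ?_
    obtain ⟨j, hj, rfl⟩ := List.mem_map.1 ha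
    obtain ⟨i, hi, rfl⟩ := List.mem_map.1 hb
    rw [List.mem_range] at hi hj
    exact (hcomm (i + 1) (2 * k + 2 + 2 * j) (by lia) (by lia) (by lia)).symm
  have hconj : C * (A₁ * B * C) * C⁻¹ = A₀ * C * E := by
    rw [hA, hEB, ← hCA.eq]
    group
  exact ⟨hconj, isConj_iff.2 ⟨C, hconj⟩⟩
end

section
/- Let G be a group, let φ : G → ℝ be a homogeneous quasi-morphism with |φ(xy) − φ(x) − φ(y)| ≤ D for all x, y ∈ G, and let x_1, …, x_n ∈ G (n ≥ 2) satisfy x_i x_j = x_j x_i whenever |i − j| ≥ 2. Then |φ(x_1 x_2 ⋯ x_n) − (φ(x_1) + φ(x_2) + ⋯ + φ(x_n))| ≤ D. -/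
theorem eq_zero_of_forall_natCast_mul_abs_le {a C : ℝ} (h : ∀ m : ℕ, m * |a| ≤ C) : a = 0 := by
  by_contra ha
  obtain ⟨m, hm⟩ := exists_nat_gt (C / |a|)
  rw [div_lt_iff₀ (abs_pos.mpr ha)] at hm
  exact (h m).not_gt hm

section HomogeneousQuasimorphism

variable {G : Type*} [Group G] {φ : G → ℝ} {D : ℝ}

/-- A homogeneous quasi-morphism is additive on commuting pairs. -/
theorem homogeneous_quasimorphism_map_mul_of_commute
    (hquasi : ∀ x y : G, |φ (x * y) - φ x - φ y| ≤ D)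
    (hhom : ∀ (x : G) (n : ℤ), φ (x ^ n) = n * φ x) {x y : G} (h : Commute x y) :
    φ (x * y) = φ x + φ y := by
  have key : φ (x * y) - φ x - φ y = 0 := by
    refine eq_zero_of_forall_natCast_mul_abs_le (C := D) fun m => ?_
    have hm := hquasi (x ^ (m : ℤ)) (y ^ (m : ℤ))
    rw [← h.mul_zpow, hhom, hhom, hhom, ← mul_sub, ← mul_sub, abs_mul] at hm
    simpa using hm
  linarith

/-- A homogeneous quasi-morphism is constant on conjugacy classes. -/
theorem homogeneous_quasimorphism_map_conj
    (hquasi : ∀ x y : G, |φ (x * y) - φ x - φ y| ≤ D)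
    (hhom : ∀ (x : G) (n : ℤ), φ (x ^ n) = n * φ x) (g x : G) :
    φ (g * x * g⁻¹) = φ x := by
  have hinv : φ g⁻¹ = -φ g := by simpa using hhom g (-1)
  have bound (y : G) : |φ (g * y * g⁻¹) - φ y| ≤ 2 * D := by
    have h1 := abs_le.mp (hquasi (g * y) g⁻¹)
    have h2 := abs_le.mp (hquasi g y)
    exact abs_le.mpr ⟨by linarith, by linarith⟩
  refine sub_eq_zero.mp (eq_zero_of_forall_natCast_mul_abs_le (C := 2 * D) fun m => ?_)
  have hm := bound (x ^ (m : ℤ))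
  rw [← conj_zpow, hhom, hhom, ← mul_sub, abs_mul] at hm
  simpa using hm

/-- A partial product of a chain is conjugate to `b * a`, where `a` and `b` collect the factors of
the two parities and `φ a + φ b` is the sum of the values of `φ` on the factors. -/
theorem exists_conj_mul_of_chain
    (hquasi : ∀ x y : G, |φ (x * y) - φ x - φ y| ≤ D)
    (hhom : ∀ (x : G) (n : ℤ), φ (x ^ n) = n * φ x) (n : ℕ) (x : ℕ → G)
    (hcomm : ∀ i j, 1 ≤ i → j ≤ n → i + 2 ≤ j → x i * x j = x j * x i) (k : ℕ) (hk : k ≤ n) :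
    ∃ g a b : G, ((List.range k).map fun i => x (i + 1)).prod = g * (b * a) * g⁻¹ ∧
      φ a + φ b = ∑ i ∈ Finset.range k, φ (x (i + 1)) ∧
      (∀ j, k + 2 ≤ j → j ≤ n → Commute a (x j)) ∧
      (∀ j, k + 1 ≤ j → j ≤ n → Commute b (x j)) ∧
      ∀ j, k + 1 ≤ j → j ≤ n → Commute g (x j) := by
  induction k with
  | zero =>
    have h1 : φ 1 = 0 := by simpa using hhom 1 0
    exact ⟨1, 1, 1, by simp, by simp [h1], by simp, by simp, by simp⟩
  | succ k ih =>
    obtain ⟨g, a, b, hprod, hsum, ha, hb, hg⟩ := ih (by omega)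
    have hbx : Commute b (x (k + 1)) := hb _ le_rfl hk
    have hgx : Commute g (x (k + 1)) := hg _ le_rfl hk
    refine ⟨g * b, b * x (k + 1), a, ?_, ?_, fun j h1 h2 => ?_, fun j h1 h2 => ?_,
      fun j h1 h2 => ?_⟩
    · rw [List.range_succ, List.map_append, List.prod_append, hprod]
      simp only [List.map_cons, List.map_nil, List.prod_cons, List.prod_nil, mul_one]
      calc g * (b * a) * g⁻¹ * x (k + 1) = g * (b * a) * (g⁻¹ * x (k + 1)) := by group
        _ = g * (b * a) * (x (k + 1) * g⁻¹) := by rw [hgx.inv_left.eq]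
        _ = g * b * (a * (x (k + 1) * b)) * (g * b)⁻¹ := by group
        _ = g * b * (a * (b * x (k + 1))) * (g * b)⁻¹ := by rw [hbx.eq]
    · rw [homogeneous_quasimorphism_map_mul_of_commute hquasi hhom hbx,
        Finset.sum_range_succ, ← hsum]
      ring
    · exact (hb j (by omega) h2).mul_left (hcomm (k + 1) j (by omega) h2 (by omega))
    · exact ha j (by omega) h2
    · exact (hg j (by omega) h2).mul_left (hb j (by omega) h2)

end HomogeneousQuasimorphism

/-- Let `φ : G → ℝ` be a homogeneous quasi-morphism with defect bound `D`
and let `x_1, …, x_n ∈ G` (with `n ≥ 2`) satisfy `x_i x_j = x_j x_i` whenever `|i − j| ≥ 2`.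
Then `|φ(x_1 x_2 ⋯ x_n) − (φ(x_1) + ⋯ + φ(x_n))| ≤ D` (a single defect, not `(n−1)D`). -/
theorem homogeneous_quasimorphism_chain_estimate {G : Type*} [Group G] (φ : G → ℝ)
    (D : ℝ) (hD : 0 ≤ D)
    (hquasi : ∀ x y : G, |φ (x * y) - φ x - φ y| ≤ D)
    (hhom : ∀ (x : G) (n : ℤ), φ (x ^ n) = n * φ x)
    (n : ℕ) (hn : 2 ≤ n) (x : ℕ → G)
    (hcomm : ∀ i j, 1 ≤ i → j ≤ n → i + 2 ≤ j → x i * x j = x j * x i) :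
    |φ (((List.range n).map fun i => x (i + 1)).prod) -
        ∑ i ∈ Finset.range n, φ (x (i + 1))| ≤ D := by
  obtain ⟨g, a, b, hprod, hsum, -⟩ := exists_conj_mul_of_chain hquasi hhom n x hcomm n le_rfl
  rw [hprod, homogeneous_quasimorphism_map_conj hquasi hhom, ← hsum, add_comm, ← sub_sub]
  exact hquasi b a
end

section
/- Let G be a group, let φ : G → ℝ be a homogeneous quasi-morphism, and let x_1, …, x_{2m} ∈ G satisfy x_i x_j = x_j x_i whenever |i − j| ≥ 2. Then φ(x_1 x_2 ⋯ x_{2m}) = φ((x_1 x_3 ⋯ x_{2m−1})·(x_2 x_4 ⋯ x_{2m})). -/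
/-- A homogeneous quasi-morphism is constant on conjugacy classes. -/
theorem homogeneous_quasimorphism_eq_of_isConj {G : Type*} [Group G] (φ : G → ℝ) (D : ℝ)
    (hquasi : ∀ x y : G, |φ (x * y) - φ x - φ y| ≤ D)
    (hhom : ∀ (x : G) (n : ℤ), φ (x ^ n) = n * φ x) {a b : G} (hab : IsConj a b) :
    φ a = φ b := by
  obtain ⟨g, rfl⟩ := isConj_iff.mp hab
  have hinv : φ g⁻¹ = -φ g := by simpa using hhom g (-1)
  have hbound (n : ℕ) : n * |φ (g * a * g⁻¹) - φ a| ≤ 2 * D := by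
    have hpow : φ (g * a ^ n * g⁻¹) = n * φ (g * a * g⁻¹) := by
      rw [← conj_pow]
      simpa using hhom (g * a * g⁻¹) n
    have hpow' : φ (a ^ n) = n * φ a := by simpa using hhom a n
    have h₁ := abs_le.mp (hquasi (g * a ^ n) g⁻¹)
    have h₂ := abs_le.mp (hquasi g (a ^ n))
    rw [← Nat.abs_cast n, ← abs_mul, mul_sub, abs_le]
    constructor <;> linarith
  by_contra hne
  have hpos : 0 < |φ (g * a * g⁻¹) - φ a| := abs_pos.mpr (sub_ne_zero.mpr (Ne.symm hne))
  obtain ⟨n, hn⟩ := exists_nat_gt (2 * D / |φ (g * a * g⁻¹) - φ a|)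
  rw [div_lt_iff₀ hpos] at hn
  exact (hbound n).not_gt hn

/-- If elements at distance at least two commute, then `x_1 ⋯ x_{2m} T` is conjugate to
`(x_1 x_3 ⋯ x_{2m-1}) (x_2 x_4 ⋯ x_{2m}) T` for every `T` commuting with `x_1, …, x_{2m-1}`. -/
theorem isConj_prod_mul_odd_mul_even_mul {G : Type*} [Group G] (x : ℕ → G) (m : ℕ)
    (hcomm : ∀ i j, 1 ≤ i → j ≤ 2 * m → i + 2 ≤ j → Commute (x i) (x j))
    (T : G) (hT : ∀ i, 1 ≤ i → i < 2 * m → Commute (x i) T) :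
    IsConj (((List.range (2 * m)).map fun k => x (k + 1)).prod * T)
      (((List.range m).map fun k => x (2 * k + 1)).prod *
        ((List.range m).map fun k => x (2 * k + 2)).prod * T) := by
  induction m generalizing T with
  | zero => simpa using IsConj.refl T
  | succ m ih =>
    have ih := ih (fun i j hi hj hij => hcomm i j hi (by omega) hij)
      (x (2 * m + 1) * x (2 * m + 2) * T) (fun i hi him =>
        ((hcomm i _ hi (by omega) (by omega)).mul_right
          (hcomm i _ hi (by omega) (by omega))).mul_right (hT i hi (by omega)))
    rw [show 2 * (m + 1) = 2 * m + 1 + 1 by ring]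
    simp only [List.range_succ, List.map_append, List.prod_append, List.map_cons, List.map_nil,
      List.prod_singleton]
    have hodd : Commute ((List.range m).map fun k => x (2 * k + 1)).prod
        (x (2 * m + 1) * x (2 * m + 2) * T) := by
      refine Commute.list_prod_left _ _ fun y hy => ?_
      obtain ⟨k, hk, rfl⟩ := List.mem_map.mp hy
      have hk := List.mem_range.mp hk
      exact ((hcomm _ _ (by omega) (by omega) (by omega)).mul_right
        (hcomm _ _ (by omega) (by omega) (by omega))).mul_right (hT _ (by omega) (by omega))
    have heven : Commute ((List.range m).map fun k => x (2 * k + 2)).prod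
        (x (2 * m + 2) * T) := by
      refine Commute.list_prod_left _ _ fun y hy => ?_
      obtain ⟨k, hk, rfl⟩ := List.mem_map.mp hy
      have hk := List.mem_range.mp hk
      exact (hcomm _ _ (by omega) (by omega) (by omega)).mul_right
        (hT _ (by omega) (by omega))
    generalize ((List.range m).map fun k => x (2 * k + 1)).prod = P at *
    generalize ((List.range m).map fun k => x (2 * k + 2)).prod = Q at *
    have hreorder : P * x (2 * m + 1) * (Q * x (2 * m + 2)) * T =
        x (2 * m + 1) * x (2 * m + 2) * T * (P * Q) := by
      calc P * x (2 * m + 1) * (Q * x (2 * m + 2)) * T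
          = P * x (2 * m + 1) * (Q * (x (2 * m + 2) * T)) := by group
        _ = P * (x (2 * m + 1) * x (2 * m + 2) * T) * Q := by rw [heven.eq]; group
        _ = _ := by rw [hodd.eq]; group
    rw [hreorder]
    have hcyc : IsConj (P * Q * (x (2 * m + 1) * x (2 * m + 2) * T))
        (x (2 * m + 1) * x (2 * m + 2) * T * (P * Q)) :=
      isConj_iff.mpr ⟨x (2 * m + 1) * x (2 * m + 2) * T, by group⟩
    simpa only [mul_assoc] using ih.trans hcyc

/-- Let `φ : G → ℝ` be a homogeneous quasi-morphism and let
`x_1, …, x_{2m} ∈ G` satisfy `x_i x_j = x_j x_i` whenever `|i − j| ≥ 2`.  Then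
`φ(x_1 x_2 ⋯ x_{2m}) = φ((x_1 x_3 ⋯ x_{2m−1}) · (x_2 x_4 ⋯ x_{2m}))`. -/
theorem homogeneous_quasimorphism_odd_even_reorder {G : Type*} [Group G] (φ : G → ℝ)
    (D : ℝ) (hD : 0 ≤ D)
    (hquasi : ∀ x y : G, |φ (x * y) - φ x - φ y| ≤ D)
    (hhom : ∀ (x : G) (n : ℤ), φ (x ^ n) = n * φ x)
    (m : ℕ) (x : ℕ → G)
    (hcomm : ∀ i j, 1 ≤ i → j ≤ 2 * m → i + 2 ≤ j → x i * x j = x j * x i) :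
    φ (((List.range (2 * m)).map fun k => x (k + 1)).prod) =
      φ (((List.range m).map fun k => x (2 * k + 1)).prod *
          ((List.range m).map fun k => x (2 * k + 2)).prod) := by
  simpa using homogeneous_quasimorphism_eq_of_isConj φ D hquasi hhom
    (isConj_prod_mul_odd_mul_even_mul x m hcomm 1 fun i _ _ => Commute.one_right (x i))
end
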